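/- Fix ρ ∈ Γ and α > 0. Suppose the coupled LMIs at ρ are feasible with solution (τᵢ, θᵢ, Xᵢ), i = 1,…,N, and define the protocol gains Kᵢⱼ := γ²Xᵢ⁻¹HᵢⱼᵀFᵢⱼ⁻¹ and Lᵢ := (γ²Xᵢ⁻¹C₂ᵢᵀ − B₂ᵢD₂ᵢᵀ)E₂ᵢ⁻¹. Then, for every solution of the fixed-parameter closed-loop system and all disturbances w₀, wᵢ, wᵢⱼ ∈ L₂[0,∞), the agents synchronize asymptotically: lim_{t→∞} Σ_{i=1}^N ‖x(t) − xᵢ(t)‖² = 0. -/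

import Mathlib

open MeasureTheory Matrix Set Filter

noncomputable section

/-- Frobenius norm of a square real matrix (a fixed choice of matrix norm). -/
def frobNorm {n : ℕ} (M : Matrix (Fin n) (Fin n) ℝ) : ℝ :=
  Real.sqrt (∑ i, ∑ j, (M i j) ^ 2)

/-- A function `f : [0,∞) → ℝ^k` belongs to `L₂[0,∞)` (its squared Euclidean
norm is integrable on `[0,∞)`). -/
def IsL2 {k : ℕ} (f : ℝ → Fin k → ℝ) : Prop :=
  MeasureTheory.IntegrableOn (fun t => f t ⬝ᵥ f t) (Set.Ici 0) MeasureTheory.volume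

/-- The data of the multi-agent network: the directed graph (given by the
in-neighbourhood sets `V i`, with no self-loops), the coefficient matrices of the
reference system, the agents, the measurements and the communication channels, the
Lipschitz-bound matrix `R`, the performance weights `Q i`, and the constants
`γ` (`gam`) and `δ i`. -/
structure NetData (n l m r r0 N : ℕ) where
  V : Fin N → Finset (Fin N)
  B1 : Matrix (Fin n) (Fin l) ℝ
  B20 : Matrix (Fin n) (Fin r0) ℝ
  B2 : Fin N → Matrix (Fin n) (Fin r) ℝ
  C2 : Fin N → Matrix (Fin m) (Fin n) ℝ
  D2 : Fin N → Matrix (Fin m) (Fin r) ℝ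
  H : Fin N → Fin N → Matrix (Fin m) (Fin n) ℝ
  G : Fin N → Fin N → Matrix (Fin m) (Fin r) ℝ
  R : Matrix (Fin n) (Fin n) ℝ
  Q : Fin N → Matrix (Fin n) (Fin n) ℝ
  gam : ℝ
  δ : Fin N → ℝ

namespace NetData

variable {n l m r r0 N : ℕ} (d : NetData n l m r r0 N)

def E (i : Fin N) : Matrix (Fin m) (Fin m) ℝ := d.D2 i * (d.D2 i)ᵀ

def F (i j : Fin N) : Matrix (Fin m) (Fin m) ℝ := d.G i j * (d.G i j)ᵀ

/-- in-degree `p i` -/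
def pdeg (i : Fin N) : ℕ := (d.V i).card

/-- out-degree `q i` -/
def qdeg (i : Fin N) : ℕ := (Finset.univ.filter fun j => i ∈ d.V j).card

/-- Standing assumptions: no self-loops, `E₂ᵢ ≻ 0`, `Fᵢⱼ ≻ 0` on edges,
`R ⪰ 0`, `γ > 0`, `δᵢ > 0`, `Qᵢ ≻ 0`. -/
def Standing : Prop :=
  (∀ i, i ∉ d.V i) ∧ (∀ i, (d.E i).PosDef) ∧ (∀ i j, j ∈ d.V i → (d.F i j).PosDef)
    ∧ d.R.PosSemidef ∧ 0 < d.gam ∧ (∀ i, 0 < d.δ i) ∧ (∀ i, (d.Q i).PosDef)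

/-- The global Lipschitz condition (4) on the nonlinearity `φ`. -/
def LipOK (φ : (Fin n → ℝ) → Fin l → ℝ) : Prop :=
  ∀ a b : Fin n → ℝ, (φ a - φ b) ⬝ᵥ (φ a - φ b) ≤ (a - b) ⬝ᵥ (d.R *ᵥ (a - b))

def Acl (Aρ : Matrix (Fin n) (Fin n) ℝ) (i : Fin N) : Matrix (Fin n) (Fin n) ℝ :=
  Aρ + d.δ i • (1 : Matrix (Fin n) (Fin n) ℝ) + d.B2 i * (d.D2 i)ᵀ * (d.E i)⁻¹ * d.C2 i

/-- The matrix `Sᵢ(ρ)` of the coupled LMIs (12), evaluated at `A(ρ) = Aρ`. -/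
def Smat (Aρ : Matrix (Fin n) (Fin n) ℝ) (X : Fin N → Matrix (Fin n) (Fin n) ℝ)
    (i : Fin N) : Matrix (Fin n) (Fin n) ℝ :=
  X i * d.Acl Aρ i + (d.Acl Aρ i)ᵀ * X i
    + ((d.pdeg i + d.qdeg i : ℕ) : ℝ) • (1 : Matrix (Fin n) (Fin n) ℝ)
    - d.gam ^ 2 • ((d.C2 i)ᵀ * (d.E i)⁻¹ * d.C2 i)
    - d.gam ^ 2 • (∑ j ∈ d.V i, (d.H i j)ᵀ * (d.F i j)⁻¹ * d.H i j)
    + d.Q i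

/-- The quadratic form of the reduced coupled LMI (18):
`z ↦ zᵀ [[Sᵢ(ρ)+τᵢR, Tᵢ],[Tᵢᵀ, −Υᵢ]] z` for `z = (ξ, a, bv, c, (v j)_{j ∈ V i})`. -/
def redQF (Aρ : Matrix (Fin n) (Fin n) ℝ) (τ : Fin N → ℝ)
    (X : Fin N → Matrix (Fin n) (Fin n) ℝ) (i : Fin N)
    (ξ : Fin n → ℝ) (a : Fin r0 → ℝ) (bv : Fin r → ℝ) (c : Fin l → ℝ)
    (v : Fin N → Fin n → ℝ) : ℝ :=
  ξ ⬝ᵥ (d.Smat Aρ X i *ᵥ ξ) + τ i * (ξ ⬝ᵥ (d.R *ᵥ ξ))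
    + 2 * (ξ ⬝ᵥ ((X i * d.B20) *ᵥ a))
    + 2 * (ξ ⬝ᵥ ((X i * d.B2 i *
        ((1 : Matrix (Fin r) (Fin r) ℝ) - (d.D2 i)ᵀ * (d.E i)⁻¹ * d.D2 i)) *ᵥ bv))
    + 2 * (ξ ⬝ᵥ ((X i * d.B1) *ᵥ c))
    + 2 * ∑ j ∈ d.V i,
        ξ ⬝ᵥ ((d.gam ^ 2 • ((d.H i j)ᵀ * (d.F i j)⁻¹ * d.H i j)
          - (1 : Matrix (Fin n) (Fin n) ℝ)) *ᵥ v j)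
    - d.gam ^ 2 * (a ⬝ᵥ a) - d.gam ^ 2 * (bv ⬝ᵥ bv) - τ i * (c ⬝ᵥ c)
    - ∑ j ∈ d.V i, (2 * d.δ j / ((d.qdeg j : ℝ) + 1)) * (v j ⬝ᵥ (X j *ᵥ v j))

/-- The reduced coupled LMIs (18): negative definiteness of each block matrix,
expressed via its quadratic form. -/
def ReducedLMI (Aρ : Matrix (Fin n) (Fin n) ℝ) (τ : Fin N → ℝ)
    (X : Fin N → Matrix (Fin n) (Fin n) ℝ) : Prop :=
  ∀ (i : Fin N) (ξ : Fin n → ℝ) (a : Fin r0 → ℝ) (bv : Fin r → ℝ) (c : Fin l → ℝ)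
    (v : Fin N → Fin n → ℝ),
    ¬(ξ = 0 ∧ a = 0 ∧ bv = 0 ∧ c = 0 ∧ ∀ j ∈ d.V i, v j = 0) →
    d.redQF Aρ τ X i ξ a bv c v < 0

/-- The quadratic form of the full coupled LMI (12), for
`z = (ξ, a, bv, c, (v j)_{j ∈ V i}, zz)`. -/
def fullQF (Aρ : Matrix (Fin n) (Fin n) ℝ) (α : ℝ) (τ θ : Fin N → ℝ)
    (X : Fin N → Matrix (Fin n) (Fin n) ℝ) (i : Fin N)
    (ξ : Fin n → ℝ) (a : Fin r0 → ℝ) (bv : Fin r → ℝ) (c : Fin l → ℝ)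
    (v : Fin N → Fin n → ℝ) (zz : Fin n → ℝ) : ℝ :=
  d.redQF Aρ τ X i ξ a bv c v + θ i * α ^ 2 * (ξ ⬝ᵥ ξ)
    + 2 * (ξ ⬝ᵥ (X i *ᵥ zz)) - θ i * (zz ⬝ᵥ zz)

/-- The coupled LMIs (12) at the point `ρ` (with `A(ρ) = Aρ`) with uncertainty
size `α`: negative definiteness of each block matrix, via its quadratic form. -/
def CoupledLMI (Aρ : Matrix (Fin n) (Fin n) ℝ) (α : ℝ) (τ θ : Fin N → ℝ)
    (X : Fin N → Matrix (Fin n) (Fin n) ℝ) : Prop :=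
  ∀ (i : Fin N) (ξ : Fin n → ℝ) (a : Fin r0 → ℝ) (bv : Fin r → ℝ) (c : Fin l → ℝ)
    (v : Fin N → Fin n → ℝ) (zz : Fin n → ℝ),
    ¬(ξ = 0 ∧ a = 0 ∧ bv = 0 ∧ c = 0 ∧ (∀ j ∈ d.V i, v j = 0) ∧ zz = 0) →
    d.fullQF Aρ α τ θ X i ξ a bv c v zz < 0

/-- Feasibility of the coupled LMIs (12): positivity of scalar variables,
positive definiteness of the `Xᵢ` and the LMIs themselves. -/
def Feasible (Aρ : Matrix (Fin n) (Fin n) ℝ) (α : ℝ) (τ θ : Fin N → ℝ)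
    (X : Fin N → Matrix (Fin n) (Fin n) ℝ) : Prop :=
  (∀ i, 0 < τ i) ∧ (∀ i, 0 < θ i) ∧ (∀ i, (X i).PosDef) ∧ d.CoupledLMI Aρ α τ θ X

/-- Interconnection gains `Kᵢⱼ = γ²Xᵢ⁻¹HᵢⱼᵀFᵢⱼ⁻¹`. -/
def Kgain (X : Fin N → Matrix (Fin n) (Fin n) ℝ) (i j : Fin N) :
    Matrix (Fin n) (Fin m) ℝ :=
  d.gam ^ 2 • ((X i)⁻¹ * (d.H i j)ᵀ * (d.F i j)⁻¹)

/-- Observer gains `Lᵢ = (γ²Xᵢ⁻¹C₂ᵢᵀ − B₂ᵢD₂ᵢᵀ)E₂ᵢ⁻¹`. -/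
def Lgain (X : Fin N → Matrix (Fin n) (Fin n) ℝ) (i : Fin N) :
    Matrix (Fin n) (Fin m) ℝ :=
  (d.gam ^ 2 • ((X i)⁻¹ * (d.C2 i)ᵀ) - d.B2 i * (d.D2 i)ᵀ) * (d.E i)⁻¹

/-- `x, (xa i)` is a solution of the closed-loop system: the reference system (5)
(with the extra uncertainty `ψ`), the agents (6), the measurements (3), and the
protocol (8) with (possibly time-varying) gains `K t i j`, `L t i`. -/
def ClosedLoop (Aρ : ℝ → Matrix (Fin n) (Fin n) ℝ)
    (φ : (Fin n → ℝ) → Fin l → ℝ) (ψ : ℝ → (Fin n → ℝ) → Fin n → ℝ)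
    (K : ℝ → Fin N → Fin N → Matrix (Fin n) (Fin m) ℝ)
    (L : ℝ → Fin N → Matrix (Fin n) (Fin m) ℝ)
    (w0 : ℝ → Fin r0 → ℝ) (w : Fin N → ℝ → Fin r → ℝ)
    (wE : Fin N → Fin N → ℝ → Fin r → ℝ)
    (x : ℝ → Fin n → ℝ) (xa : Fin N → ℝ → Fin n → ℝ) : Prop :=
  (∀ t ∈ Ici (0:ℝ),
    HasDerivAt x (Aρ t *ᵥ x t + d.B1 *ᵥ φ (x t) + d.B20 *ᵥ w0 t + ψ t (x t)) t) ∧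
  ∀ i, ∀ t ∈ Ici (0:ℝ),
    HasDerivAt (xa i)
      (Aρ t *ᵥ xa i t + d.B1 *ᵥ φ (xa i t) + ψ t (xa i t)
        + (L t i *ᵥ ((d.C2 i *ᵥ x t + d.D2 i *ᵥ w i t) - d.C2 i *ᵥ xa i t)
          + ∑ j ∈ d.V i, K t i j *ᵥ ((d.H i j *ᵥ xa j t + d.G i j *ᵥ wE i j t)
              - d.H i j *ᵥ xa i t))
        + d.B2 i *ᵥ w i t) t

/-- The disagreement function `Ψ_G` (11). -/
def disagree (e : Fin N → Fin n → ℝ) : ℝ :=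
  (1 / (N : ℝ)) * ∑ i, ∑ j ∈ d.V i, (e j - e i) ⬝ᵥ (e j - e i)

/-- `‖(x₀,w₀,w,w̄)‖²` with `P = diag[(1/N)Xᵢ]`. -/
def distSq (X : Fin N → Matrix (Fin n) (Fin n) ℝ) (x0 : Fin n → ℝ)
    (x0a : Fin N → Fin n → ℝ) (w0 : ℝ → Fin r0 → ℝ) (w : Fin N → ℝ → Fin r → ℝ)
    (wE : Fin N → Fin N → ℝ → Fin r → ℝ) : ℝ :=
  (1 / (N : ℝ)) * ∑ i, (x0 - x0a i) ⬝ᵥ (X i *ᵥ (x0 - x0a i))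
    + (∫ t in Ici (0:ℝ), w0 t ⬝ᵥ w0 t)
    + (1 / (N : ℝ)) * ∑ i, ((∫ t in Ici (0:ℝ), w i t ⬝ᵥ w i t)
        + ∑ j ∈ d.V i, ∫ t in Ici (0:ℝ), wE i j t ⬝ᵥ wE i j t)

end NetData

/-- Completing the square in a weighted least-squares expression, where the weight is the inverse
of the Gram matrix `D * Dᵀ`. -/
lemma neg_dotProduct_self_le_of_posDef_gram {m n r : ℕ} {D : Matrix (Fin m) (Fin r) ℝ}
    (hD : (D * Dᵀ).PosDef) (C : Matrix (Fin m) (Fin n) ℝ) (e : Fin n → ℝ) (w : Fin r → ℝ) :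
    -(w ⬝ᵥ w) ≤ e ⬝ᵥ (Cᵀ *ᵥ (D * Dᵀ)⁻¹ *ᵥ C *ᵥ e)
      + 2 * (e ⬝ᵥ (Cᵀ *ᵥ (D * Dᵀ)⁻¹ *ᵥ D *ᵥ w)) := by
  have hdet : IsUnit (D * Dᵀ).det := (isUnit_iff_isUnit_det _).1 hD.isUnit
  have hsymm : ((D * Dᵀ)⁻¹)ᵀ = (D * Dᵀ)⁻¹ := by
    rw [transpose_nonsing_inv, transpose_mul, transpose_transpose]
  have hcross (z : Fin r → ℝ) :
      (Dᵀ *ᵥ (D * Dᵀ)⁻¹ *ᵥ C *ᵥ e) ⬝ᵥ z = e ⬝ᵥ (Cᵀ *ᵥ (D * Dᵀ)⁻¹ *ᵥ D *ᵥ z) := by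
    rw [mulVec_transpose D, ← dotProduct_mulVec, ← hsymm, mulVec_transpose, ← dotProduct_mulVec,
      hsymm, mulVec_transpose C, dotProduct_comm e, ← dotProduct_mulVec, dotProduct_comm]
  have hself := hcross (Dᵀ *ᵥ (D * Dᵀ)⁻¹ *ᵥ C *ᵥ e)
  rw [mulVec_mulVec _ D Dᵀ, mulVec_mulVec _ (D * Dᵀ), mul_nonsing_inv _ hdet,
    one_mulVec] at hself
  have hnonneg := dotProduct_self_star_nonneg (Dᵀ *ᵥ (D * Dᵀ)⁻¹ *ᵥ C *ᵥ e + w)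
  simp only [star_trivial, add_dotProduct, dotProduct_add, hself, hcross,
    dotProduct_comm w (Dᵀ *ᵥ _)] at hnonneg
  linarith

/-- A curve tends to zero as soon as a positive definite quadratic form tends to zero along it. -/
lemma tendsto_dotProduct_self_of_posDef {n : ℕ} {X : Matrix (Fin n) (Fin n) ℝ} (hX : X.PosDef)
    {β : Type*} {F : Filter β} {e : β → Fin n → ℝ}
    (h : Tendsto (fun t => e t ⬝ᵥ (X *ᵥ e t)) F (nhds 0)) :
    Tendsto (fun t => e t ⬝ᵥ e t) F (nhds 0) := by
  obtain ⟨y, rfl⟩ : ∃ y : Matrix (Fin n) (Fin n) ℝ, X = yᵀ * y := by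
    open scoped MatrixOrder in
    obtain ⟨y, hy⟩ := CStarAlgebra.nonneg_iff_eq_star_mul_self.mp hX.posSemidef.nonneg
    exact ⟨y, by rw [hy, star_eq_conjTranspose, conjTranspose_eq_transpose_of_trivial]⟩
  have hdet : IsUnit y.det := by
    have hX' := (isUnit_iff_isUnit_det _).1 hX.isUnit
    rw [det_mul] at hX'
    exact isUnit_of_mul_isUnit_right hX'
  have hsq (t : β) : e t ⬝ᵥ ((yᵀ * y) *ᵥ e t) = ∑ i, (y *ᵥ e t) i ^ 2 := by
    rw [← mulVec_mulVec, mulVec_transpose, dotProduct_comm, ← dotProduct_mulVec]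
    simp [dotProduct, pow_two]
  simp only [hsq] at h
  have hy : Tendsto (fun t => y *ᵥ e t) F (nhds 0) := by
    refine tendsto_pi_nhds.2 fun i => ?_
    have hi : Tendsto (fun t => (y *ᵥ e t) i ^ 2) F (nhds 0) :=
      squeeze_zero (fun t => sq_nonneg _)
        (fun t => Finset.single_le_sum (f := fun i => (y *ᵥ e t) i ^ 2)
          (fun j _ => sq_nonneg _) (Finset.mem_univ i)) h
    have habs := hi.sqrt
    simp only [Real.sqrt_sq_eq_abs, Real.sqrt_zero] at habs
    exact (tendsto_zero_iff_abs_tendsto_zero _).2 habs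
  have hcont : Continuous fun z : Fin n → ℝ => (y⁻¹ *ᵥ z) ⬝ᵥ (y⁻¹ *ᵥ z) := by fun_prop
  have := (hcont.tendsto 0).comp hy
  simpa [Function.comp_def, mulVec_mulVec, nonsing_inv_mul _ hdet] using this

lemma HasDerivAt.quadForm {n : ℕ} {X : Matrix (Fin n) (Fin n) ℝ} (hX : X.IsHermitian)
    {e : ℝ → Fin n → ℝ} {e' : Fin n → ℝ} {t : ℝ} (he : HasDerivAt e e' t) :
    HasDerivAt (fun s => e s ⬝ᵥ (X *ᵥ e s)) (2 * (e t ⬝ᵥ (X *ᵥ e'))) t := by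
  have hcoord := hasDerivAt_pi.1 he
  have hmul : HasDerivAt (fun s => e s ⬝ᵥ (X *ᵥ e s))
      (∑ i, (e' i * (X *ᵥ e t) i + e t i * (X *ᵥ e') i)) t := by
    refine HasDerivAt.fun_sum fun i _ => (hcoord i).mul ?_
    simp only [mulVec, dotProduct]
    exact HasDerivAt.fun_sum fun j _ => (hcoord j).const_mul (X i j)
  convert hmul using 1
  have hsymm : e' ⬝ᵥ (X *ᵥ e t) = e t ⬝ᵥ (X *ᵥ e') := by
    rw [dotProduct_comm, ← hX.eq, conjTranspose_eq_transpose_of_trivial, mulVec_transpose,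
      ← dotProduct_mulVec, ← conjTranspose_eq_transpose_of_trivial, hX.eq]
  rw [Finset.sum_add_distrib]
  change _ = e' ⬝ᵥ (X *ᵥ e t) + e t ⬝ᵥ (X *ᵥ e')
  rw [hsymm, two_mul]

/-- A nonnegative function with `V' ≤ -ε V + g`, `ε > 0` and `g` nonnegative and integrable on
`[0,∞)`, tends to zero at infinity. -/
lemma tendsto_zero_of_deriv_le_neg_mul_add {V V' g : ℝ → ℝ} {ε : ℝ} (hε : 0 < ε)
    (hV : ∀ t, 0 ≤ t → 0 ≤ V t) (hderiv : ∀ t, 0 ≤ t → HasDerivAt V (V' t) t)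
    (hle : ∀ t, 0 ≤ t → V' t ≤ -ε * V t + g t) (hg : ∀ t, 0 ≤ g t)
    (hgint : IntegrableOn g (Ici 0)) : Tendsto V atTop (nhds 0) := by
  have hgI (a b : ℝ) (ha : 0 ≤ a) (hab : a ≤ b) : IntervalIntegrable g volume a b := by
    rw [intervalIntegrable_iff_integrableOn_Icc_of_le hab]
    exact hgint.mono_set fun u hu => ha.trans hu.1
  have hgronwall (a b : ℝ) (ha : 0 ≤ a) (hab : a ≤ b) :
      V b ≤ Real.exp (-ε * (b - a)) * V a + ∫ u in a..b, g u := by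
    have hexp (t : ℝ) : HasDerivAt (fun u => Real.exp (-ε * (b - u)))
        (Real.exp (-ε * (b - t)) * ε) t := by
      have := (((hasDerivAt_id t).const_sub b).const_mul (-ε)).exp
      simpa using this
    have hprod (t : ℝ) (ht : 0 ≤ t) := (hexp t).mul (hderiv t ht)
    have key := intervalIntegral.sub_le_integral_of_hasDeriv_right_of_le (φ := g) hab
      (fun t ht => (hprod t (ha.trans ht.1)).continuousAt.continuousWithinAt)
      (fun t ht => (hprod t (ha.trans ht.1.le)).hasDerivWithinAt)
      (hgint.mono_set fun u hu => ha.trans hu.1) fun t ht => by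
        have h1 : Real.exp (-ε * (b - t)) ≤ 1 := by
          rw [Real.exp_le_one_iff]
          nlinarith [ht.2]
        have h2 := mul_le_mul_of_nonneg_left (hle t (ha.trans ht.1.le))
          (Real.exp_pos (-ε * (b - t))).le
        have h3 := mul_le_mul_of_nonneg_right h1 (hg t)
        linarith
    simp only [Pi.mul_apply, sub_self, mul_zero, Real.exp_zero, one_mul] at key
    linarith
  have hG := intervalIntegral_tendsto_integral_Ioi 0
    (hgint.mono_set Ioi_subset_Ici_self) tendsto_id
  simp only [id] at hG
  set I := ∫ u in Ioi (0 : ℝ), g u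
  refine Metric.tendsto_atTop.2 fun η hη => ?_
  obtain ⟨s, hs⟩ := Metric.tendsto_atTop.1 hG (η / 4) (by positivity)
  set a := max s 0
  have hdecay : Tendsto (fun b => Real.exp (-ε * (b - a)) * V a) atTop (nhds 0) := by
    have hlin : Tendsto (fun b : ℝ => -ε * (b - a)) atTop atBot :=
      (tendsto_atTop_add_const_right _ (-a) tendsto_id).const_mul_atTop_of_neg (neg_lt_zero.2 hε)
    simpa using (Real.tendsto_exp_atBot.comp hlin).mul_const (V a)
  obtain ⟨T, hT⟩ := Metric.tendsto_atTop.1 hdecay (η / 2) (by positivity)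
  refine ⟨max T a, fun b hb => ?_⟩
  have ha : 0 ≤ a := le_max_right _ _
  have hab : a ≤ b := (le_max_right _ _).trans hb
  have h1 := hgronwall a b ha hab
  have h2 := hT b ((le_max_left _ _).trans hb)
  have h3 := hs a (le_max_left _ _)
  have h4 := hs b ((le_max_left _ _).trans hab)
  have h5 := intervalIntegral.integral_add_adjacent_intervals (hgI 0 a le_rfl ha) (hgI a b ha hab)
  rw [Real.dist_eq, abs_lt] at h2 h3 h4
  rw [Real.dist_eq, sub_zero, abs_of_nonneg (hV b (ha.trans hab))]
  linarith [h2.2, h3.1, h4.2]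

namespace NetData

variable {n l m r r0 N : ℕ} (d : NetData n l m r r0 N)

/-- The right-hand side of the equation for the synchronization error of agent `i`; `Φ` and `Ψ`
stand for the increments of the nonlinearity and of the uncertainty. -/
def errorField (Aρ : Matrix (Fin n) (Fin n) ℝ) (X : Fin N → Matrix (Fin n) (Fin n) ℝ) (i : Fin N)
    (e : Fin N → Fin n → ℝ) (w0 : Fin r0 → ℝ) (w : Fin r → ℝ) (wE : Fin N → Fin r → ℝ)
    (Φ : Fin l → ℝ) (Ψ : Fin n → ℝ) : Fin n → ℝ :=
  Aρ *ᵥ e i + d.B1 *ᵥ Φ + d.B20 *ᵥ w0 + Ψ - d.Lgain X i *ᵥ (d.C2 i *ᵥ e i + d.D2 i *ᵥ w)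
    - ∑ j ∈ d.V i, d.Kgain X i j *ᵥ (d.H i j *ᵥ (e i - e j) + d.G i j *ᵥ wE j)
    - d.B2 i *ᵥ w

variable {d}

lemma dotProduct_Smat_mulVec (Aρ : Matrix (Fin n) (Fin n) ℝ)
    {X : Fin N → Matrix (Fin n) (Fin n) ℝ} {i : Fin N} (hX : (X i).IsHermitian) (ξ : Fin n → ℝ) :
    ξ ⬝ᵥ (d.Smat Aρ X i *ᵥ ξ) =
      2 * (ξ ⬝ᵥ (X i *ᵥ Aρ *ᵥ ξ)) + 2 * d.δ i * (ξ ⬝ᵥ (X i *ᵥ ξ))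
      + 2 * (ξ ⬝ᵥ (X i *ᵥ d.B2 i *ᵥ (d.D2 i)ᵀ *ᵥ (d.E i)⁻¹ *ᵥ d.C2 i *ᵥ ξ))
      + ((d.pdeg i : ℝ) + d.qdeg i) * (ξ ⬝ᵥ ξ)
      - d.gam ^ 2 * (ξ ⬝ᵥ ((d.C2 i)ᵀ *ᵥ (d.E i)⁻¹ *ᵥ d.C2 i *ᵥ ξ))
      - d.gam ^ 2 * ∑ j ∈ d.V i, ξ ⬝ᵥ ((d.H i j)ᵀ *ᵥ (d.F i j)⁻¹ *ᵥ d.H i j *ᵥ ξ)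
      + ξ ⬝ᵥ (d.Q i *ᵥ ξ) := by
  have hsymm : ξ ⬝ᵥ (((d.Acl Aρ i)ᵀ * X i) *ᵥ ξ) = ξ ⬝ᵥ ((X i * d.Acl Aρ i) *ᵥ ξ) := by
    rw [dotProduct_mulVec, ← mulVec_transpose, transpose_mul, transpose_transpose,
      ← conjTranspose_eq_transpose_of_trivial, hX.eq, dotProduct_comm]
  simp only [Smat, add_mulVec, sub_mulVec, dotProduct_add, dotProduct_sub, hsymm]
  simp only [Acl, ← mulVec_mulVec, add_mulVec, smul_mulVec, one_mulVec, mulVec_add, mulVec_smul,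
    sum_mulVec, dotProduct_add, dotProduct_sum, dotProduct_smul, smul_eq_mul]
  push_cast
  ring

/-- Along the error dynamics the storage function of agent `i` obeys a dissipation inequality. -/
lemma dissipation_le (hstand : d.Standing) {Aρ : Matrix (Fin n) (Fin n) ℝ} {α : ℝ}
    {τ θ : Fin N → ℝ} {X : Fin N → Matrix (Fin n) (Fin n) ℝ} (hfeas : d.Feasible Aρ α τ θ X)
    (i : Fin N) (e : Fin N → Fin n → ℝ) (w0 : Fin r0 → ℝ) (w : Fin r → ℝ)
    (wE : Fin N → Fin r → ℝ) {Φ : Fin l → ℝ} {Ψ : Fin n → ℝ}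
    (hΦ : Φ ⬝ᵥ Φ ≤ e i ⬝ᵥ (d.R *ᵥ e i)) (hΨ : Ψ ⬝ᵥ Ψ ≤ α ^ 2 * (e i ⬝ᵥ e i)) :
    2 * (e i ⬝ᵥ (X i *ᵥ d.errorField Aρ X i e w0 w wE Φ Ψ)) ≤
      d.gam ^ 2 * (w0 ⬝ᵥ w0 + 2 * (w ⬝ᵥ w) + ∑ j ∈ d.V i, wE j ⬝ᵥ wE j)
      + ∑ j ∈ d.V i, 2 * d.δ j / ((d.qdeg j : ℝ) + 1) * (e j ⬝ᵥ (X j *ᵥ e j))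
      - 2 * d.δ i * (e i ⬝ᵥ (X i *ᵥ e i))
      + (2 * ∑ j ∈ d.V i, e i ⬝ᵥ e j - ((d.pdeg i : ℝ) + d.qdeg i) * (e i ⬝ᵥ e i)) := by
  obtain ⟨-, hE, hF, -, -, -, hQ⟩ := hstand
  obtain ⟨hτ, hθ, hX, hlmi⟩ := hfeas
  have hfull : d.fullQF Aρ α τ θ X i (e i) w0 (-w) Φ e Ψ ≤ 0 := by
    by_cases hz : e i = 0 ∧ w0 = 0 ∧ -w = 0 ∧ Φ = 0 ∧ (∀ j ∈ d.V i, e j = 0) ∧ Ψ = 0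
    · obtain ⟨h1, h2, h3, h4, h5, h6⟩ := hz
      have hv : ∑ j ∈ d.V i, 2 * d.δ j / ((d.qdeg j : ℝ) + 1) * (e j ⬝ᵥ (X j *ᵥ e j)) = 0 :=
        Finset.sum_eq_zero fun j hj => by simp [h5 j hj]
      simp [fullQF, redQF, h1, h2, h3, h4, h6, hv]
    · exact (hlmi i _ _ _ _ _ _ hz).le
  have hXinv (v : Fin n → ℝ) : X i *ᵥ (X i)⁻¹ *ᵥ v = v := by
    rw [mulVec_mulVec, mul_nonsing_inv _ ((isUnit_iff_isUnit_det _).1 (hX i).isUnit), one_mulVec]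
  have hQi : 0 ≤ e i ⬝ᵥ (d.Q i *ᵥ e i) := (hQ i).posSemidef.dotProduct_mulVec_nonneg (e i)
  have hCD := mul_le_mul_of_nonneg_left
    (neg_dotProduct_self_le_of_posDef_gram (hE i) (d.C2 i) (e i) w) (sq_nonneg d.gam)
  have hHG := mul_le_mul_of_nonneg_left (Finset.sum_le_sum fun j hj =>
    neg_dotProduct_self_le_of_posDef_gram (hF i j hj) (d.H i j) (e i) (wE j)) (sq_nonneg d.gam)
  have hτΦ := mul_le_mul_of_nonneg_left hΦ (hτ i).le
  have hθΨ := mul_le_mul_of_nonneg_left hΨ (hθ i).le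
  simp only [← E.eq_def, ← F.eq_def] at hCD hHG
  simp only [fullQF, redQF, dotProduct_Smat_mulVec Aρ (hX i).isHermitian] at hfull
  simp only [errorField, Lgain, Kgain, ← mulVec_mulVec, sub_mulVec, smul_mulVec,
    one_mulVec, mulVec_add, mulVec_sub, mulVec_smul, mulVec_neg, neg_dotProduct, dotProduct_neg,
    neg_neg, mulVec_sum, hXinv, dotProduct_add, dotProduct_sub, dotProduct_sum,
    dotProduct_smul, smul_eq_mul, Finset.sum_add_distrib, Finset.sum_sub_distrib,
    Finset.sum_neg_distrib, ← Finset.mul_sum] at hfull hCD hHG ⊢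
  linarith

lemma sum_sum_in_neighbours (f : Fin N → ℝ) :
    ∑ i, ∑ j ∈ d.V i, f j = ∑ j, (d.qdeg j : ℝ) * f j := by
  rw [Finset.sum_comm' (t' := Finset.univ) (s' := fun j => Finset.univ.filter fun i => j ∈ d.V i)
    (by simp)]
  simp [qdeg]

/-- The coupling terms sum to minus the total disagreement along the edges. -/
lemma sum_coupling_nonpos (e : Fin N → Fin n → ℝ) :
    ∑ i, (2 * ∑ j ∈ d.V i, e i ⬝ᵥ e j - ((d.pdeg i : ℝ) + d.qdeg i) * (e i ⬝ᵥ e i)) ≤ 0 := by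
  have hsq : 0 ≤ ∑ i, ∑ j ∈ d.V i, (e i - e j) ⬝ᵥ (e i - e j) :=
    Finset.sum_nonneg fun i _ => Finset.sum_nonneg fun j _ => dotProduct_self_star_nonneg _
  have hexpand (i j : Fin N) :
      (e i - e j) ⬝ᵥ (e i - e j) = e i ⬝ᵥ e i + e j ⬝ᵥ e j - 2 * (e i ⬝ᵥ e j) := by
    simp only [dotProduct_sub, sub_dotProduct, dotProduct_comm (e j) (e i)]
    ring
  simp only [hexpand, Finset.sum_sub_distrib, Finset.sum_add_distrib,
    sum_sum_in_neighbours fun j => e j ⬝ᵥ e j, Finset.sum_const, nsmul_eq_mul] at hsq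
  simp only [Finset.sum_sub_distrib, add_mul, Finset.sum_add_distrib, pdeg, Finset.mul_sum]
  linarith

lemma hasDerivAt_error {Aρ : Matrix (Fin n) (Fin n) ℝ} {φ : (Fin n → ℝ) → Fin l → ℝ}
    {ψ : ℝ → (Fin n → ℝ) → Fin n → ℝ} {X : Fin N → Matrix (Fin n) (Fin n) ℝ}
    {w0 : ℝ → Fin r0 → ℝ} {w : Fin N → ℝ → Fin r → ℝ} {wE : Fin N → Fin N → ℝ → Fin r → ℝ}
    {x : ℝ → Fin n → ℝ} {xa : Fin N → ℝ → Fin n → ℝ}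
    (hcl : d.ClosedLoop (fun _ => Aρ) φ ψ
      (fun _ => d.Kgain X) (fun _ => d.Lgain X) w0 w wE x xa)
    (i : Fin N) {t : ℝ} (ht : 0 ≤ t) :
    HasDerivAt (fun s => x s - xa i s)
      (d.errorField Aρ X i (fun j => x t - xa j t) (w0 t) (w i t) (fun j => wE i j t)
        (φ (x t) - φ (xa i t)) (ψ t (x t) - ψ t (xa i t))) t := by
  refine ((hcl.1 t ht).fun_sub (hcl.2 i t ht)).congr_deriv (Eq.symm ?_)
  have hdiff (j : Fin N) : x t - xa i t - (x t - xa j t) = xa j t - xa i t := by abel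
  have hK (j : Fin N) : d.H i j *ᵥ (xa j t - xa i t) + d.G i j *ᵥ wE i j t =
      d.H i j *ᵥ xa j t + d.G i j *ᵥ wE i j t - d.H i j *ᵥ xa i t := by
    rw [mulVec_sub]; abel
  have hL : d.C2 i *ᵥ (x t - xa i t) + d.D2 i *ᵥ w i t =
      d.C2 i *ᵥ x t + d.D2 i *ᵥ w i t - d.C2 i *ᵥ xa i t := by
    rw [mulVec_sub]; abel
  simp only [errorField, hdiff, hK, hL]
  rw [mulVec_sub Aρ, mulVec_sub d.B1]
  abel

end NetData

/-- **Lemma 1, property (iii) (STATEMENT 2).** For fixed `ρ`, if the coupled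
LMIs (12) at `ρ` are feasible and the protocol gains are chosen as in (13)–(14),
then for all `L₂` disturbances the agents synchronize asymptotically:
`Σᵢ ‖x(t) − xᵢ(t)‖² → 0` as `t → ∞`. -/
theorem fixed_param_asymptotic_sync
    {n l m r r0 N : ℕ} (hN : 0 < N) (d : NetData n l m r r0 N) (hstand : d.Standing)
    (φ : (Fin n → ℝ) → Fin l → ℝ) (hφ : d.LipOK φ)
    (Aρ : Matrix (Fin n) (Fin n) ℝ) (α : ℝ) (hα : 0 < α)
    (ψ : ℝ → (Fin n → ℝ) → Fin n → ℝ)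
    (hψ : ∀ t : ℝ, ∀ a b : Fin n → ℝ,
      (ψ t a - ψ t b) ⬝ᵥ (ψ t a - ψ t b) ≤ α ^ 2 * ((a - b) ⬝ᵥ (a - b)))
    (τ θ : Fin N → ℝ) (X : Fin N → Matrix (Fin n) (Fin n) ℝ)
    (hfeas : d.Feasible Aρ α τ θ X)
    (w0 : ℝ → Fin r0 → ℝ) (w : Fin N → ℝ → Fin r → ℝ)
    (wE : Fin N → Fin N → ℝ → Fin r → ℝ)
    (hw0 : IsL2 w0) (hw : ∀ i, IsL2 (w i)) (hwE : ∀ i j, j ∈ d.V i → IsL2 (wE i j))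
    (x : ℝ → Fin n → ℝ) (xa : Fin N → ℝ → Fin n → ℝ)
    (hcl : d.ClosedLoop (fun _ => Aρ) φ ψ
      (fun _ => d.Kgain X) (fun _ => d.Lgain X) w0 w wE x xa) :
    Filter.Tendsto (fun t => ∑ i, (x t - xa i t) ⬝ᵥ (x t - xa i t))
      Filter.atTop (nhds 0) := by
  have hX : ∀ i, (X i).PosDef := hfeas.2.2.1
  have hδ : ∀ i, 0 < d.δ i := hstand.2.2.2.2.2.1
  obtain ⟨i₀, -, hmin⟩ := Finset.exists_min_image Finset.univ
    (fun i => 2 * d.δ i / ((d.qdeg i : ℝ) + 1)) ⟨⟨0, hN⟩, Finset.mem_univ _⟩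
  set ε := 2 * d.δ i₀ / ((d.qdeg i₀ : ℝ) + 1)
  have hε : 0 < ε := by have := hδ i₀; positivity
  have hnonneg (i : Fin N) (t : ℝ) : 0 ≤ (x t - xa i t) ⬝ᵥ (X i *ᵥ (x t - xa i t)) :=
    (hX i).posSemidef.dotProduct_mulVec_nonneg _
  have hdot {k : ℕ} (v : Fin k → ℝ) : 0 ≤ v ⬝ᵥ v := dotProduct_self_star_nonneg v
  have hstorage : Tendsto (fun t => ∑ i, (x t - xa i t) ⬝ᵥ (X i *ᵥ (x t - xa i t)))
      atTop (nhds 0) := by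
    refine tendsto_zero_of_deriv_le_neg_mul_add (g := fun t => ∑ i, d.gam ^ 2 *
        (w0 t ⬝ᵥ w0 t + 2 * (w i t ⬝ᵥ w i t) + ∑ j ∈ d.V i, wE i j t ⬝ᵥ wE i j t))
      hε (fun t _ => Finset.sum_nonneg fun i _ => hnonneg i t)
      (fun t ht => HasDerivAt.fun_sum fun i _ =>
        (NetData.hasDerivAt_error hcl i ht).quadForm (hX i).isHermitian)
      (fun t _ => ?_) (fun t => ?_) ?_
    · have hdiss := Finset.sum_le_sum fun i (_ : i ∈ Finset.univ) =>
        NetData.dissipation_le hstand hfeas i (fun j => x t - xa j t) (w0 t) (w i t)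
          (fun j => wE i j t) (hφ (x t) (xa i t)) (hψ t (x t) (xa i t))
      have hcoup := d.sum_coupling_nonpos fun j => x t - xa j t
      refine hdiss.trans ?_
      rw [Finset.sum_add_distrib, Finset.sum_sub_distrib, Finset.sum_add_distrib,
        NetData.sum_sum_in_neighbours fun j => 2 * d.δ j / ((d.qdeg j : ℝ) + 1) *
          ((x t - xa j t) ⬝ᵥ (X j *ᵥ (x t - xa j t)))]
      have hdecay : ε * ∑ i, (x t - xa i t) ⬝ᵥ (X i *ᵥ (x t - xa i t)) ≤
          ∑ i, 2 * d.δ i * ((x t - xa i t) ⬝ᵥ (X i *ᵥ (x t - xa i t))) -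
          ∑ i, (d.qdeg i : ℝ) * (2 * d.δ i / ((d.qdeg i : ℝ) + 1) *
            ((x t - xa i t) ⬝ᵥ (X i *ᵥ (x t - xa i t)))) := by
        rw [Finset.mul_sum, ← Finset.sum_sub_distrib]
        refine Finset.sum_le_sum fun i _ =>
          (mul_le_mul_of_nonneg_right (hmin i (Finset.mem_univ i)) (hnonneg i t)).trans_eq ?_
        field_simp
        ring
      linarith
    · exact Finset.sum_nonneg fun i _ => mul_nonneg (sq_nonneg _) <|
        add_nonneg (add_nonneg (hdot _) (mul_nonneg zero_le_two (hdot _)))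
          (Finset.sum_nonneg fun j _ => hdot _)
    · exact integrable_finsetSum _ fun i _ =>
        ((Integrable.add hw0 ((hw i).const_mul 2)).add
          (integrable_finsetSum _ fun j hj => hwE i j hj)).const_mul _
  have hsync (i : Fin N) :
      Tendsto (fun t => (x t - xa i t) ⬝ᵥ (x t - xa i t)) atTop (nhds 0) :=
    tendsto_dotProduct_self_of_posDef (hX i) <|
      squeeze_zero (hnonneg i) (fun t => Finset.single_le_sum
        (f := fun i => (x t - xa i t) ⬝ᵥ (X i *ᵥ (x t - xa i t)))
        (fun j _ => hnonneg j t) (Finset.mem_univ i)) hstorage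
  simpa using tendsto_finsetSum Finset.univ fun i _ => hsync i
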